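/- arXiv:1201.2015 — 2 statements merged into one kernel-verified Lean document; each statement's English description precedes it below -/
import Mathlib

section
/- Let n ≥ 3 be an odd integer. Define h(z) = ∫₀^z (1−ζⁿ)^{−2/n} (1−ζ²)^{−1} dζ and g(z) = ∫₀^z ζ² (1−ζⁿ)^{−2/n} (1−ζ²)^{−1} dζ for z ∈ 𝔻 (these are the shears of the regular n-gon mapping φ(z) = ∫₀^z (1−ζⁿ)^{−2/n} dζ with dilatation ω(z) = z²). Then the harmonic function f = h + conj(g) is injective on 𝔻 and f(𝔻) is convex in the horizontal direction. -/
open Complex Set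
open scoped Real

noncomputable section

/-- The open unit disk in the complex plane. -/
def unitDisk : Set ℂ := Metric.ball 0 1

/-- A set is convex in the horizontal direction (CHD) if its intersection with
every horizontal line is connected (possibly empty). -/
def IsCHD (Ω : Set ℂ) : Prop := ∀ t : ℝ, IsPreconnected {z | z ∈ Ω ∧ z.im = t}

/-- Integral of `f` along the line segment from `0` to `z`. -/
def segInt (f : ℂ → ℂ) (z : ℂ) : ℂ := ∫ t in (0:ℝ)..1, z * f ((t : ℂ) * z)

/-- Pochhammer symbol `(a)_m = a (a+1) ⋯ (a+m-1)`. -/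
def poch (a : ℂ) (m : ℕ) : ℂ := ∏ i ∈ Finset.range m, (a + i)

/-- Appell's first hypergeometric function `F₁(a, b₁, b₂; c; x, y)`. -/
def appellF1 (a b₁ b₂ c x y : ℂ) : ℂ :=
  ∑' (k : ℕ) (l : ℕ),
    poch a (k + l) * poch b₁ k * poch b₂ l /
      (poch c (k + l) * (Nat.factorial k : ℂ) * (Nat.factorial l : ℂ)) * x ^ k * y ^ l

/-- The half-plane positivity of the Cayley transform on the unit disk. -/
lemma re_cayley_pos {w : ℂ} (hw : ‖w‖ < 1) : 0 < ((1 + w) / (1 - w)).re := by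
  have hne : 1 - w ≠ 0 := fun h => by
    rw [← sub_eq_zero.mp h] at hw
    simp at hw
  have hsq : w.re * w.re + w.im * w.im < 1 := by
    have h1 : ‖w‖ ^ 2 < 1 := by nlinarith [norm_nonneg w]
    rwa [← Complex.normSq_eq_norm_sq, Complex.normSq_apply] at h1
  have hpos : 0 < Complex.normSq (1 - w) := Complex.normSq_pos.mpr hne
  have key : ((1 + w) / (1 - w)).re =
      (1 - (w.re * w.re + w.im * w.im)) / Complex.normSq (1 - w) := by
    rw [Complex.div_re, ← add_div]
    congr 1
    simp
    ring
  rw [key]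
  exact div_pos (by linarith) hpos

lemma one_sub_pow_re_pos {m : ℕ} (hm : m ≠ 0) {z : ℂ} (hz : ‖z‖ < 1) : 0 < (1 - z ^ m).re := by
  have h1 : ‖z ^ m‖ < 1 := by
    rw [norm_pow]
    exact pow_lt_one₀ (norm_nonneg z) hz hm
  have h2 := (Complex.re_le_norm (z ^ m)).trans_lt h1
  simp only [Complex.sub_re, Complex.one_re]
  linarith

/-- Integration along radii yields a primitive of a holomorphic function on the disk. -/
lemma hasDerivAt_segInt {f : ℂ → ℂ} (hf : DifferentiableOn ℂ f (Metric.ball 0 1)) {z : ℂ}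
    (hz : z ∈ Metric.ball (0 : ℂ) 1) : HasDerivAt (segInt f) (f z) z := by
  obtain ⟨G, hG⟩ := hf.isExactOn_ball
  have hseg : ∀ w ∈ Metric.ball (0 : ℂ) 1, segInt f w = G w - G 0 := by
    intro w hw
    have hmem : ∀ t ∈ Icc (0 : ℝ) 1, (t : ℂ) * w ∈ Metric.ball (0 : ℂ) 1 := by
      intro t ht
      rw [mem_ball_zero_iff] at hw ⊢
      rw [norm_mul, Complex.norm_real, Real.norm_of_nonneg ht.1]
      exact (mul_le_of_le_one_left (norm_nonneg w) ht.2).trans_lt hw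
    have hd : ∀ t ∈ uIcc (0 : ℝ) 1,
        HasDerivAt (fun t : ℝ => G ((t : ℂ) * w)) (w * f ((t : ℂ) * w)) t := by
      intro t ht
      rw [uIcc_of_le zero_le_one] at ht
      have h1 : HasDerivAt (fun t : ℝ => (t : ℂ) * w) w t := by
        simpa using (Complex.ofRealCLM.hasDerivAt (x := t)).mul_const w
      exact ((hG _ (hmem t ht)).comp t h1).congr_deriv (mul_comm _ _)
    have hc : ContinuousOn (fun t : ℝ => w * f ((t : ℂ) * w)) (uIcc 0 1) := by
      rw [uIcc_of_le zero_le_one]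
      exact continuousOn_const.mul
        (hf.continuousOn.comp (by fun_prop) hmem)
    simpa [segInt] using
      intervalIntegral.integral_eq_sub_of_hasDerivAt hd hc.intervalIntegrable
  refine ((hG z hz).sub_const (G 0)).congr_of_eventuallyEq ?_
  filter_upwards [Metric.isOpen_ball.mem_nhds hz] with w hw using hseg w hw

/-- **Noshiro–Warschawski**: a holomorphic function on a convex set whose derivative has positive
real part is injective. -/
lemma injOn_of_deriv_re_pos {φ p : ℂ → ℂ} {s : Set ℂ} (hs : Convex ℝ s)
    (hφ : ∀ z ∈ s, HasDerivAt φ (p z) z) (hp : ∀ z ∈ s, 0 < (p z).re) : InjOn φ s := by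
  intro a ha b hb hab
  by_contra hne
  have hba : b - a ≠ 0 := sub_ne_zero.mpr (Ne.symm hne)
  have hmem : ∀ t ∈ Icc (0 : ℝ) 1, a + (t : ℂ) * (b - a) ∈ s := by
    intro t ht
    have := hs.add_smul_sub_mem ha hb ht
    simpa [Complex.real_smul] using this
  have hd : ∀ t ∈ Icc (0 : ℝ) 1, HasDerivAt
      (fun t : ℝ => (φ (a + (t : ℂ) * (b - a)) / (b - a)).re) (p (a + (t : ℂ) * (b - a))).re t := by
    intro t ht
    have h1 : HasDerivAt (fun t : ℝ => a + (t : ℂ) * (b - a)) (b - a) t := by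
      simpa using ((Complex.ofRealCLM.hasDerivAt (x := t)).mul_const (b - a)).const_add a
    have h2 := ((hφ _ (hmem t ht)).comp t h1).div_const (b - a)
    rw [mul_div_cancel_right₀ _ hba] at h2
    exact Complex.reCLM.hasFDerivAt.comp_hasDerivAt t h2
  obtain ⟨c, hc, hc0⟩ := exists_hasDerivAt_eq_zero zero_lt_one
    (fun t ht => (hd t ht).continuousAt.continuousWithinAt) (by simp [hab])
    (fun t ht => hd t (Ioo_subset_Icc_self ht))
  exact (hp _ (hmem c (Ioo_subset_Icc_self hc))).ne' hc0

/-- A periodic function whose derivative has the sign of `cos ∘ ψ`, where the phase `ψ` increases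
by one full turn per period, takes no value three times in a period. -/
lemma not_three_eq_of_deriv_cos {u R ψ : ℝ → ℝ} (hu : ∀ θ, HasDerivAt u (R θ * Real.cos (ψ θ)) θ)
    (hR : ∀ θ, 0 < R θ) (hψ : StrictMono ψ) (hψp : ∀ θ, ψ (θ + 2 * π) = ψ θ + 2 * π)
    (hup : ∀ θ, u (θ + 2 * π) = u θ) {a b c : ℝ} (hab : a < b) (hbc : b < c)
    (hca : c < a + 2 * π) (h1 : u a = u b) (h2 : u b = u c) : False := by
  have rolle : ∀ x y, x < y → u x = u y → ∃ z ∈ Ioo x y, ∃ k : ℤ, ψ z = (2 * k + 1) * π / 2 := by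
    intro x y hxy he
    obtain ⟨z, hz, hz0⟩ := exists_hasDerivAt_eq_zero hxy
      (fun t _ => (hu t).continuousAt.continuousWithinAt) he (fun t _ => hu t)
    exact ⟨z, hz, Real.cos_eq_zero_iff.mp ((mul_eq_zero.mp hz0).resolve_left (hR z).ne')⟩
  obtain ⟨x, hx, k, hk⟩ := rolle a b hab h1
  obtain ⟨y, hy, l, hl⟩ := rolle b c hbc h2
  obtain ⟨z, hz, m, hm⟩ := rolle c (a + 2 * π) hca (by rw [hup, h1, h2])
  have e1 : ψ x < ψ y := hψ (hx.2.trans hy.1)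
  have e2 : ψ y < ψ z := hψ (hy.2.trans hz.1)
  have e3 : ψ z < ψ x + 2 * π := by
    rw [← hψp]
    exact hψ (by linarith [hz.2, hx.1])
  have hpi := Real.pi_pos
  have f1 : (k : ℝ) < l := by
    rw [hk, hl] at e1
    nlinarith
  have f2 : (l : ℝ) < m := by
    rw [hl, hm] at e2
    nlinarith
  have f3 : (m : ℝ) < k + 2 := by
    rw [hm, hk] at e3
    nlinarith
  norm_cast at f1 f2 f3
  omega

lemma exists_mem_frontier_of_mem_of_notMem {V : Set ℝ} {x y : ℝ} (hx : x ∈ V) (hy : y ∉ V) :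
    ∃ p ∈ uIcc x y, p ∈ frontier V := by
  by_contra! hcon
  have hsub : uIcc x y ⊆ interior V ∪ (closure V)ᶜ := by
    intro p hp
    by_cases hc : p ∈ closure V
    · exact Or.inl (by_contra fun hi => hcon p hp ⟨hc, hi⟩)
    · exact Or.inr hc
  obtain ⟨q, -, hq1, hq2⟩ := isPreconnected_uIcc _ _ isOpen_interior isClosed_closure.isOpen_compl
    hsub ⟨x, left_mem_uIcc, (hsub left_mem_uIcc).resolve_right fun h => h (subset_closure hx)⟩
    ⟨y, right_mem_uIcc, (hsub right_mem_uIcc).resolve_left fun h => hy (interior_subset h)⟩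
  exact hq2 (subset_closure (interior_subset hq1))

lemma hasStrictDerivAt_of_forall_hasDerivAt {φ p : ℂ → ℂ} {s : Set ℂ} (hs : IsOpen s)
    (hφ : ∀ z ∈ s, HasDerivAt φ (p z) z) {z : ℂ} (hz : z ∈ s) : HasStrictDerivAt φ (p z) z := by
  have hd : DifferentiableOn ℂ φ s :=
    fun w hw => (hφ w hw).differentiableAt.differentiableWithinAt
  have := (hd.analyticAt (hs.mem_nhds hz)).hasStrictDerivAt
  rwa [(hφ z hz).deriv] at this

/-- If a locally univalent function on the disk takes, on each circle about the origin, no value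
of the imaginary part three times, then the horizontal slices of its image are intervals. -/
lemma ordConnected_slice {φ p : ℂ → ℂ} (hφ : ∀ z ∈ Metric.ball (0 : ℂ) 1, HasDerivAt φ (p z) z)
    (hp : ∀ z ∈ Metric.ball (0 : ℂ) 1, p z ≠ 0)
    (hcirc : ∀ r : ℝ, 0 < r → r < 1 → ∀ z₁ z₂ z₃ : ℂ, ‖z₁‖ = r → ‖z₂‖ = r → ‖z₃‖ = r →
      z₁ ≠ z₂ → z₂ ≠ z₃ → z₁ ≠ z₃ → (φ z₁).im = (φ z₂).im → (φ z₂).im = (φ z₃).im → False)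
    (t : ℝ) : OrdConnected {x : ℝ | (x + t * I : ℂ) ∈ φ '' Metric.ball 0 1} := by
  refine ⟨?_⟩
  rintro a ⟨za, hza, hfa⟩ b ⟨zb, hzb, hfb⟩ c ⟨hac, hcb⟩
  by_contra hc
  rw [mem_ball_zero_iff] at hza hzb
  obtain ⟨r, hr, hr1⟩ := exists_between (max_lt hza hzb)
  obtain ⟨har, hbr⟩ := max_lt_iff.mp hr
  have hr0 : 0 < r := (norm_nonneg za).trans_lt har
  have hsub : Metric.closedBall (0 : ℂ) r ⊆ Metric.ball 0 1 := Metric.closedBall_subset_ball hr1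
  have hsub' : Metric.ball (0 : ℂ) r ⊆ Metric.ball 0 1 := Metric.ball_subset_ball hr1.le
  set j : ℝ → ℂ := fun x => x + t * I with hj
  have hjc : Continuous j := by fun_prop
  have hjre : ∀ x, (j x).re = x := fun x => by simp [hj]
  have hjim : ∀ x, (j x).im = t := fun x => by simp [hj]
  set V : Set ℝ := j ⁻¹' (φ '' Metric.ball 0 r)
  have hVo : IsOpen V := by
    refine IsOpen.preimage hjc (isOpen_iff_mem_nhds.mpr ?_)
    rintro _ ⟨z, hz, rfl⟩
    rw [← (hasStrictDerivAt_of_forall_hasDerivAt Metric.isOpen_ball hφ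
      (hsub' hz)).map_nhds_eq (hp z (hsub' hz))]
    exact Filter.image_mem_map (Metric.isOpen_ball.mem_nhds hz)
  have hK : IsCompact (φ '' Metric.closedBall 0 r) :=
    (isCompact_closedBall 0 r).image_of_continuousOn
      fun z hz => (hφ z (hsub hz)).continuousAt.continuousWithinAt
  obtain ⟨B, hB⟩ := hK.isBounded.exists_norm_le
  have hVB : ∀ x ∈ V, |x| ≤ B := by
    rintro x ⟨z, hz, hzx⟩
    have := (Complex.abs_re_le_norm (j x)).trans
      (hzx ▸ hB _ (mem_image_of_mem φ (Metric.ball_subset_closedBall hz)))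
    rwa [hjre] at this
  have hfr : ∀ x ∈ frontier V, x ∉ V ∧ ∃ z, ‖z‖ = r ∧ φ z = j x := by
    intro x hx
    rw [hVo.frontier_eq] at hx
    refine ⟨hx.2, ?_⟩
    have hcl : closure V ⊆ j ⁻¹' (φ '' Metric.closedBall 0 r) :=
      closure_minimal (preimage_mono (image_mono Metric.ball_subset_closedBall))
        (hK.isClosed.preimage hjc)
    obtain ⟨z, hz, hzx⟩ := hcl hx.1
    refine ⟨z, ?_, hzx⟩
    rw [mem_closedBall_zero_iff] at hz
    exact hz.eq_of_not_lt fun hlt => hx.2 ⟨z, mem_ball_zero_iff.mpr hlt, hzx⟩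
  have haV : a ∈ V := ⟨za, mem_ball_zero_iff.mpr har, hfa⟩
  have hbV : b ∈ V := ⟨zb, mem_ball_zero_iff.mpr hbr, hfb⟩
  have hcV : c ∉ V := fun h => hc (image_mono hsub' h)
  have hlo : a - (2 * B + 1) ∉ V := fun h => by
    linarith [(abs_le.mp (hVB _ h)).1, (abs_le.mp (hVB _ haV)).2]
  have hhi : b + (2 * B + 1) ∉ V := fun h => by
    linarith [(abs_le.mp (hVB _ h)).2, (abs_le.mp (hVB _ hbV)).1]
  have hB0 : 0 ≤ B := (abs_nonneg a).trans (hVB a haV)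
  obtain ⟨x₁, hx₁, hx₁f⟩ := exists_mem_frontier_of_mem_of_notMem haV hlo
  obtain ⟨x₂, hx₂, hx₂f⟩ := exists_mem_frontier_of_mem_of_notMem haV hcV
  obtain ⟨x₃, hx₃, hx₃f⟩ := exists_mem_frontier_of_mem_of_notMem hbV hhi
  rw [uIcc_of_ge (by linarith)] at hx₁
  rw [uIcc_of_le hac] at hx₂
  rw [uIcc_of_le (by linarith)] at hx₃
  obtain ⟨hx₁V, z₁, hz₁, e₁⟩ := hfr x₁ hx₁f
  obtain ⟨hx₂V, z₂, hz₂, e₂⟩ := hfr x₂ hx₂f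
  obtain ⟨hx₃V, z₃, hz₃, e₃⟩ := hfr x₃ hx₃f
  have l₁ : x₁ < a := hx₁.2.lt_of_ne fun h => hx₁V (h ▸ haV)
  have l₃ : b < x₃ := hx₃.1.lt_of_ne fun h => hx₃V (h ▸ hbV)
  have hne : ∀ {x y : ℝ} {z w : ℂ}, φ z = j x → φ w = j y → x < y → z ≠ w := by
    rintro x y z w hz hw hxy rfl
    have := congrArg Complex.re (hz.symm.trans hw)
    rw [hjre, hjre] at this
    exact hxy.ne this
  exact hcirc r hr0 hr1 z₁ z₂ z₃ hz₁ hz₂ hz₃ (hne e₁ e₂ (by linarith [hx₂.1]))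
    (hne e₂ e₃ (by linarith [hx₂.2])) (hne e₁ e₃ (by linarith))
    (by rw [e₁, e₂, hjim, hjim]) (by rw [e₂, e₃, hjim, hjim])

/-- **Clunie–Sheil-Small shear construction**: if `h - g` is univalent and its image has interval
horizontal slices, and `dh + dg` divided by `dh - dg` has positive real part,
then `h + conj g` is univalent and convex in the horizontal direction. -/
lemma shear_injOn_and_isCHD {h g dh dg : ℂ → ℂ} {s : Set ℂ} (hs : IsOpen s)
    (hh : ∀ z ∈ s, HasDerivAt h (dh z) z) (hg : ∀ z ∈ s, HasDerivAt g (dg z) z)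
    (hinj : InjOn (fun z => h z - g z) s)
    (hslice : ∀ t : ℝ, OrdConnected {x : ℝ | (x + t * I : ℂ) ∈ (fun z => h z - g z) '' s})
    (hne : ∀ z ∈ s, dh z - dg z ≠ 0)
    (hpos : ∀ z ∈ s, 0 < ((dh z + dg z) / (dh z - dg z)).re) :
    InjOn (fun z => h z + (starRingEnd ℂ) (g z)) s ∧
      IsCHD ((fun z => h z + (starRingEnd ℂ) (g z)) '' s) := by
  set φ : ℂ → ℂ := fun z => h z - g z with hφdef
  set k : ℂ → ℂ := Function.invFunOn φ s
  have hleft : ∀ z ∈ s, k (φ z) = z := fun z hz => hinj.leftInvOn_invFunOn hz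
  have hkd : ∀ z ∈ s, HasDerivAt k (dh z - dg z)⁻¹ (φ z) := fun z hz =>
    ((hasStrictDerivAt_of_forall_hasDerivAt hs
      (fun w hw => (hh w hw).sub (hg w hw)) hz).to_local_left_inverse (hne z hz)
      (Filter.mem_of_superset (hs.mem_nhds hz) hleft)).hasDerivAt
  set F : ℝ → ℝ → ℝ := fun t x => (h (k (x + t * I)) + g (k (x + t * I))).re with hF
  have hFd : ∀ t x : ℝ, ∀ z ∈ s, φ z = x + t * I →
      HasDerivAt (F t) ((dh z + dg z) / (dh z - dg z)).re x := by
    intro t x z hz hzx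
    have h1 : HasDerivAt (fun x : ℝ => (x + t * I : ℂ)) 1 x :=
      (Complex.ofRealCLM.hasDerivAt (x := x)).add_const (t * I)
    have h2 : HasDerivAt (fun w => h w + g w) (dh z + dg z) (k (x + t * I)) := by
      rw [← hzx, hleft z hz]
      exact (hh z hz).add (hg z hz)
    have h3 : HasDerivAt k (dh z - dg z)⁻¹ (x + t * I : ℂ) := hzx ▸ hkd z hz
    have h4 := (h2.comp (x + t * I : ℂ) h3).comp x h1
    rw [mul_one, ← div_eq_mul_inv] at h4
    exact Complex.reCLM.hasFDerivAt.comp_hasDerivAt x h4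
  have hFre : ∀ z ∈ s, F (φ z).im (φ z).re = (h z + (starRingEnd ℂ) (g z)).re := by
    intro z hz
    simp only [hF, Complex.re_add_im, hleft z hz, Complex.add_re, Complex.conj_re]
  have him : ∀ z, (h z + (starRingEnd ℂ) (g z)).im = (φ z).im := by
    intro z
    simp [hφdef, sub_eq_add_neg]
  have hcont : ∀ t, ContinuousOn (F t) {x : ℝ | (x + t * I : ℂ) ∈ φ '' s} := by
    rintro t x ⟨z, hz, hzx⟩
    exact (hFd t x z hz hzx).continuousAt.continuousWithinAt
  have hmono : ∀ t, StrictMonoOn (F t) {x : ℝ | (x + t * I : ℂ) ∈ φ '' s} := by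
    intro t
    refine strictMonoOn_of_deriv_pos (hslice t).convex (hcont t) fun x hx => ?_
    obtain ⟨z, hz, hzx⟩ := interior_subset hx
    rw [(hFd t x z hz hzx).deriv]
    exact hpos z hz
  constructor
  · intro z hz w hw hzw
    have e1 : (φ z).im = (φ w).im := by
      rw [← him, ← him]
      exact congrArg Complex.im hzw
    have e2 : F (φ z).im (φ z).re = F (φ z).im (φ w).re := by
      rw [hFre z hz]
      nth_rewrite 1 [e1]
      rw [hFre w hw]
      exact congrArg Complex.re hzw
    have e3 : (φ z).re = (φ w).re := (hmono (φ z).im).injOn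
      ⟨z, hz, by rw [Complex.re_add_im]⟩ ⟨w, hw, by rw [e1, Complex.re_add_im]⟩ e2
    exact hinj hz hw (Complex.ext e3 e1)
  · intro t
    have heq : {w | w ∈ (fun z => h z + (starRingEnd ℂ) (g z)) '' s ∧ w.im = t} =
        (fun x : ℝ => (F t x + t * I : ℂ)) '' {x : ℝ | (x + t * I : ℂ) ∈ φ '' s} := by
      ext w
      constructor
      · rintro ⟨⟨z, hz, rfl⟩, ht⟩
        have ht' : (φ z).im = t := by rw [← him]; exact ht
        refine ⟨(φ z).re, ⟨z, hz, by rw [← ht', Complex.re_add_im]⟩, ?_⟩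
        have := hFre z hz
        rw [ht'] at this
        simp only [this]
        exact Complex.ext (by simp) (by simpa using ht.symm)
      · rintro ⟨x, ⟨z, hz, hzx⟩, rfl⟩
        have hre : (φ z).re = x := by rw [hzx]; simp
        have ht : (φ z).im = t := by rw [hzx]; simp
        refine ⟨⟨z, hz, ?_⟩, by simp⟩
        have := hFre z hz
        rw [ht, hre] at this
        refine Complex.ext ?_ ?_
        · simp [this]
        · rw [him, ht]
          simp
    rw [heq]
    refine (hslice t).isPreconnected.image _ ?_
    exact (Complex.continuous_ofReal.comp_continuousOn (hcont t)).add continuousOn_const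

/-- On each circle about the origin the imaginary part of the polygon mapping takes no value
three times. -/
lemma polygon_circle {n : ℕ} (hn : n ≠ 0) {φ : ℂ → ℂ}
    (hφ : ∀ z ∈ Metric.ball (0 : ℂ) 1, HasDerivAt φ ((1 - z ^ n) ^ (-(2 / (n : ℂ)))) z)
    {r : ℝ} (hr0 : 0 < r) (hr1 : r < 1) {z₁ z₂ z₃ : ℂ} (hz₁ : ‖z₁‖ = r) (hz₂ : ‖z₂‖ = r)
    (hz₃ : ‖z₃‖ = r) (h12 : z₁ ≠ z₂) (h23 : z₂ ≠ z₃) (h13 : z₁ ≠ z₃)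
    (e12 : (φ z₁).im = (φ z₂).im) (e23 : (φ z₂).im = (φ z₃).im) : False := by
  set γ : ℝ → ℂ := fun θ => r * exp (θ * I) with hγ
  have hnorm : ∀ θ, ‖γ θ‖ < 1 := fun θ => by
    simpa [hγ, Complex.norm_exp_ofReal_mul_I, abs_of_pos hr0] using hr1
  have hγp : ∀ θ, γ (θ + 2 * π) = γ θ := fun θ => by
    simp only [hγ]
    rw [← Complex.exp_periodic (θ * I)]
    push_cast
    ring_nf
  have hγd : ∀ θ, HasDerivAt γ (γ θ * I) θ := by
    intro θ
    have h1 : HasDerivAt (fun θ : ℝ => (θ : ℂ) * I) I θ := by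
      simpa using (Complex.ofRealCLM.hasDerivAt (x := θ)).mul_const I
    simpa [hγ, mul_assoc] using h1.cexp.const_mul (r : ℂ)
  have hslit : ∀ θ, 1 - γ θ ^ n ∈ slitPlane := fun θ =>
    Or.inl (one_sub_pow_re_pos hn (hnorm θ))
  set L : ℝ → ℂ := fun θ => Real.log r + θ * I - 2 / n * log (1 - γ θ ^ n) with hL
  have hexp : ∀ θ, γ θ * (1 - γ θ ^ n) ^ (-(2 / (n : ℂ))) = exp (L θ) := by
    intro θ
    rw [Complex.cpow_def_of_ne_zero (slitPlane_ne_zero (hslit θ)), hL]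
    simp only [sub_eq_add_neg, Complex.exp_add]
    rw [← Complex.ofReal_exp, Real.exp_log hr0]
    simp only [hγ]
    ring_nf
  have hLd : ∀ θ, HasDerivAt L (I * ((1 + γ θ ^ n) / (1 - γ θ ^ n))) θ := by
    intro θ
    have h1 : HasDerivAt (fun θ : ℝ => (Real.log r : ℂ) + (θ : ℂ) * I) I θ := by
      simpa using ((Complex.ofRealCLM.hasDerivAt (x := θ)).mul_const I).const_add (Real.log r : ℂ)
    have h2 := h1.sub (((((hγd θ).pow n).const_sub 1).clog_real (hslit θ)).const_mul (2 / (n : ℂ)))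
    refine h2.congr_deriv ?_
    have hne := slitPlane_ne_zero (hslit θ)
    have hpow : γ θ ^ n = γ θ ^ (n - 1) * γ θ := (pow_sub_one_mul hn _).symm
    simp only [Pi.pow_apply]
    field_simp
    rw [hpow]
    ring
  have hψ : StrictMono fun θ => (L θ).im := by
    refine strictMono_of_hasDerivAt_pos
      (fun θ => Complex.imCLM.hasFDerivAt.comp_hasDerivAt θ (hLd θ)) fun θ => ?_
    have := re_cayley_pos (w := γ θ ^ n) (by
      rw [norm_pow]
      exact pow_lt_one₀ (norm_nonneg _) (hnorm θ) hn)
    simpa using this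
  have hψp : ∀ θ, (L (θ + 2 * π)).im = (L θ).im + 2 * π := by
    intro θ
    simp only [hL, hγp]
    simp
    ring
  have hu : ∀ θ, HasDerivAt (fun θ => (φ (γ θ)).im)
      (Real.exp (L θ).re * Real.cos (L θ).im) θ := by
    intro θ
    have h1 := Complex.imCLM.hasFDerivAt.comp_hasDerivAt θ
      ((hφ (γ θ) (mem_ball_zero_iff.mpr (hnorm θ))).comp θ (hγd θ))
    refine h1.congr_deriv ?_
    rw [← Complex.exp_re, ← hexp, ← mul_assoc, mul_comm _ (γ θ), Complex.imCLM_apply,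
      Complex.mul_I_im]
  have hup : ∀ θ, (φ (γ (θ + 2 * π))).im = (φ (γ θ)).im := fun θ => by rw [hγp]
  have harg : ∀ z, ‖z‖ = r → γ (arg z) = z := fun z hz => by
    simp only [hγ]
    rw [← hz, Complex.norm_mul_exp_arg_mul_I]
  have key : ∀ x y z : ℂ, ‖x‖ = r → ‖y‖ = r → ‖z‖ = r → arg x < arg y → arg y < arg z →
      (φ x).im = (φ y).im → (φ y).im = (φ z).im → False := by
    intro x y z hx hy hz hxy hyz e1 e2
    refine not_three_eq_of_deriv_cos hu (fun θ => Real.exp_pos _) hψ hψp hup hxy hyz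
      ?_ ?_ ?_
    · linarith [Complex.neg_pi_lt_arg x, Complex.arg_le_pi z]
    · simpa only [harg x hx, harg y hy] using e1
    · simpa only [harg y hy, harg z hz] using e2
  have hargne : ∀ x y : ℂ, ‖x‖ = r → ‖y‖ = r → x ≠ y → arg x ≠ arg y := by
    intro x y hx hy hxy h
    exact hxy (by rw [← harg x hx, ← harg y hy, h])
  have e13 := e12.trans e23
  rcases lt_or_gt_of_ne (hargne _ _ hz₁ hz₂ h12) with a | a <;>
  rcases lt_or_gt_of_ne (hargne _ _ hz₂ hz₃ h23) with b | b <;>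
  rcases lt_or_gt_of_ne (hargne _ _ hz₁ hz₃ h13) with c | c
  · exact key z₁ z₂ z₃ hz₁ hz₂ hz₃ a b e12 e23
  · exact key z₁ z₂ z₃ hz₁ hz₂ hz₃ a b e12 e23
  · exact key z₁ z₃ z₂ hz₁ hz₃ hz₂ c b e13 e23.symm
  · exact key z₃ z₁ z₂ hz₃ hz₁ hz₂ c a e13.symm e12
  · exact key z₂ z₁ z₃ hz₂ hz₁ hz₃ a c e12.symm e13
  · exact key z₂ z₃ z₁ hz₂ hz₃ hz₁ b c e23 e13.symm
  · exact key z₃ z₂ z₁ hz₃ hz₂ hz₁ b a e23.symm e12.symm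
  · exact key z₃ z₂ z₁ hz₃ hz₂ hz₁ b a e23.symm e12.symm

lemma polygon_deriv_re_pos {n : ℕ} (hn : 2 ≤ n) {z : ℂ} (hz : ‖z‖ < 1) :
    0 < ((1 - z ^ n) ^ (-(2 / (n : ℂ)))).re := by
  have hre := one_sub_pow_re_pos (by omega : n ≠ 0) hz
  have hne : 1 - z ^ n ≠ 0 := fun h => by simp [h] at hre
  have hcast : -(2 / (n : ℂ)) = ((-(2 / n : ℝ) : ℝ) : ℂ) := by push_cast; rfl
  rw [Complex.cpow_def_of_ne_zero hne, Complex.exp_re, hcast]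
  refine mul_pos (Real.exp_pos _) (Real.cos_pos_of_mem_Ioo ?_)
  rw [Complex.im_mul_ofReal, Complex.log_im]
  have harg := Complex.abs_arg_lt_pi_div_two_iff.mpr (Or.inl hre)
  have hn' : (2 : ℝ) / n ≤ 1 := by
    rw [div_le_one (by positivity)]
    exact_mod_cast hn
  have habs : |arg (1 - z ^ n) * -(2 / n : ℝ)| < π / 2 := by
    rw [abs_mul, abs_neg, abs_of_nonneg (by positivity : (0 : ℝ) ≤ 2 / n)]
    exact (mul_le_of_le_one_right (abs_nonneg _) hn').trans_lt harg
  exact abs_lt.mp habs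

theorem polygon_shear_z2_univalent_CHD
    (n : ℕ) (hodd : Odd n) (hn : 3 ≤ n) :
    let h : ℂ → ℂ := fun z =>
      segInt (fun ζ => (1 - ζ ^ n) ^ (-(2 / (n : ℂ))) * (1 - ζ ^ 2)⁻¹) z
    let g : ℂ → ℂ := fun z =>
      segInt (fun ζ => ζ ^ 2 * (1 - ζ ^ n) ^ (-(2 / (n : ℂ))) * (1 - ζ ^ 2)⁻¹) z
    let f : ℂ → ℂ := fun z => h z + (starRingEnd ℂ) (g z)
    Set.InjOn f unitDisk ∧ IsCHD (f '' unitDisk) := by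
  intro h g f
  have hn0 : n ≠ 0 := by omega
  have hne : ∀ z ∈ unitDisk, (1 - z ^ 2 : ℂ) ≠ 0 := fun z hz hzero => by
    have := one_sub_pow_re_pos two_ne_zero (mem_ball_zero_iff.mp hz)
    simp [hzero] at this
  have hpd : DifferentiableOn ℂ (fun ζ : ℂ => (1 - ζ ^ n) ^ (-(2 / (n : ℂ)))) unitDisk := by
    intro z hz
    exact (DifferentiableAt.cpow_const (f := fun ζ : ℂ => 1 - ζ ^ n) (by fun_prop)
      (Or.inl (one_sub_pow_re_pos hn0 (mem_ball_zero_iff.mp hz)))).differentiableWithinAt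
  have hid : DifferentiableOn ℂ (fun ζ : ℂ => (1 - ζ ^ 2)⁻¹) unitDisk :=
    DifferentiableOn.inv (by fun_prop) hne
  have hh : ∀ z ∈ unitDisk, HasDerivAt h _ z := fun z hz => hasDerivAt_segInt (hpd.mul hid) hz
  have hg : ∀ z ∈ unitDisk, HasDerivAt g _ z := fun z hz =>
    hasDerivAt_segInt (((differentiableOn_id.pow 2).mul hpd).mul hid) hz
  have hsub : ∀ z ∈ unitDisk, (1 - z ^ n) ^ (-(2 / (n : ℂ))) * (1 - z ^ 2)⁻¹ -
      z ^ 2 * (1 - z ^ n) ^ (-(2 / (n : ℂ))) * (1 - z ^ 2)⁻¹ = (1 - z ^ n) ^ (-(2 / (n : ℂ))) := by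
    intro z hz
    have := hne z hz
    field_simp
  have hφ : ∀ z ∈ unitDisk, HasDerivAt (fun z => h z - g z) ((1 - z ^ n) ^ (-(2 / (n : ℂ)))) z :=
    fun z hz => ((hh z hz).sub (hg z hz)).congr_deriv (hsub z hz)
  have hre : ∀ z ∈ unitDisk, 0 < ((1 - z ^ n) ^ (-(2 / (n : ℂ)))).re := fun z hz =>
    polygon_deriv_re_pos (by omega) (mem_ball_zero_iff.mp hz)
  have hp : ∀ z ∈ unitDisk, (1 - z ^ n) ^ (-(2 / (n : ℂ))) ≠ 0 := fun z hz hzero => by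
    simpa [hzero] using hre z hz
  refine shear_injOn_and_isCHD Metric.isOpen_ball hh hg
    (injOn_of_deriv_re_pos (convex_ball 0 1) hφ hre)
    (ordConnected_slice hφ hp fun r hr0 hr1 z₁ z₂ z₃ => polygon_circle hn0 hφ hr0 hr1)
    (fun z hz => ?_) fun z hz => ?_
  · exact (hsub z hz).trans_ne (hp z hz)
  · have hz2 : ‖z ^ 2‖ < 1 := by
      rw [norm_pow]
      exact pow_lt_one₀ (norm_nonneg z) (mem_ball_zero_iff.mp hz) two_ne_zero
    convert re_cayley_pos hz2 using 2
    simp only [Pi.mul_apply, Pi.pow_apply]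
    rw [hsub z hz]
    have h1 := hne z hz
    have h2 := hp z hz
    field_simp
end
end

section
/- Let n ≥ 1 be an odd integer. For every z ∈ 𝔻, the Weierstrass–Enneper height function ψ(z) = ∫₀^z ζ (1−ζⁿ)^{−2/n} (1−ζ²)^{−1} dζ of the shear of the regular n-gon mapping with dilatation ω(z) = z² satisfies ψ(z) = Σ_{k=0}^{n−1} (z^{2(k+1)}/(2(k+1))) · F₁(2(k+1)/n, 1+2/n, 1; 1+2(k+1)/n; zⁿ, −zⁿ), where the integral is along the segment from 0 to z and (1−ζⁿ)^{−2/n} denotes the principal power. -/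
open Complex Set
open scoped Real

noncomputable section

lemma poch_eq_ascPochhammer_eval (a : ℂ) (m : ℕ) : poch a m = (ascPochhammer ℂ m).eval a := by
  induction m with
  | zero => simp [poch]
  | succ m ih =>
    rw [ascPochhammer_succ_eval, ← ih, poch, poch, Finset.prod_range_succ]

lemma poch_one (m : ℕ) : poch 1 m = (Nat.factorial m : ℂ) := by
  rw [poch_eq_ascPochhammer_eval, ascPochhammer_eval_one]

lemma poch_ne_zero {a : ℂ} (ha : 0 < a.re) (m : ℕ) : poch a m ≠ 0 := by
  refine Finset.prod_ne_zero_iff.2 fun i _ h => ?_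
  have h' := congrArg Complex.re h
  simp only [add_re, natCast_re, zero_re] at h'
  have : (0 : ℝ) ≤ i := Nat.cast_nonneg i
  linarith

lemma poch_mul_add (a : ℂ) (m : ℕ) : poch a m * (a + m) = a * poch (1 + a) m := by
  induction m with
  | zero => simp [poch]
  | succ m ih =>
    have h (b : ℂ) : poch b (m + 1) = poch b m * (b + m) := by
      simp [poch, Finset.prod_range_succ]
    rw [h, h, ih]
    push_cast
    ring

lemma poch_div_poch_one_add {a : ℂ} (ha : 0 < a.re) (m : ℕ) :
    poch a m / poch (1 + a) m = a / (a + m) := by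
  have h1 : poch (1 + a) m ≠ 0 := poch_ne_zero (by simp; linarith) m
  have h2 : a + m ≠ 0 := fun h => by
    have h' := congrArg Complex.re h
    simp only [add_re, natCast_re, zero_re] at h'
    have : (0 : ℝ) ≤ m := Nat.cast_nonneg m
    linarith
  rw [div_eq_div_iff h1 h2, poch_mul_add]

lemma hasSum_one_sub_cpow_neg (b : ℂ) {w : ℂ} (hw : ‖w‖ < 1) :
    HasSum (fun k : ℕ => poch b k / (Nat.factorial k : ℂ) * w ^ k) ((1 - w) ^ (-b)) := by
  have h := (one_div_one_sub_cpow_hasFPowerSeriesOnBall_zero b).hasSum (y := w)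
    (by rw [← ENNReal.ofReal_one, Metric.eball_ofReal]; simpa using hw)
  rw [zero_add, one_div, ← cpow_neg] at h
  refine h.congr_fun fun k => ?_
  have hk := Ring.factorial_nsmul_multichoose_eq_ascPochhammer b k
  rw [Ring.multichoose_eq, Polynomial.ascPochhammer_smeval_eq_eval,
    ← poch_eq_ascPochhammer_eval, nsmul_eq_mul] at hk
  rw [← hk, mul_div_cancel_left₀ _ (by exact_mod_cast Nat.factorial_ne_zero k)]
  simp [mul_comm]

lemma hasSum_one_sub_cpow_neg_mul_inv (b : ℂ) {w : ℂ} (hw : ‖w‖ < 1) :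
    HasSum (fun i : ℕ × ℕ => poch b i.1 / (Nat.factorial i.1 : ℂ) * w ^ i.1 * (-w) ^ i.2)
      ((1 - w) ^ (-b) * (1 + w)⁻¹) := by
  have h1 := hasSum_one_sub_cpow_neg b hw
  have hw' : ‖-w‖ < 1 := by rwa [norm_neg]
  have h2 := hasSum_geometric_of_norm_lt_one hw'
  rw [sub_neg_eq_add] at h2
  have hs := summable_mul_of_summable_norm h1.summable.norm h2.summable.norm
  exact h1.mul h2 hs

lemma norm_ofReal_mul_pow_lt_one {n : ℕ} (hn : 1 ≤ n) {z : ℂ} (hz : ‖z‖ < 1) {t : ℝ}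
    (ht : t ∈ Icc (0 : ℝ) 1) : ‖((t : ℂ) * z) ^ n‖ < 1 := by
  rw [norm_pow, norm_mul, norm_real, Real.norm_of_nonneg ht.1]
  refine pow_lt_one₀ (mul_nonneg ht.1 (norm_nonneg z)) ?_ (by omega)
  nlinarith [ht.1, ht.2, norm_nonneg z]

/-- Euler-type integral representation of `F₁` at `(zⁿ, -zⁿ)`. -/
lemma integral_eq_appellF1 {n : ℕ} (hn : 1 ≤ n) (p : ℕ) (b : ℂ) {z : ℂ} (hz : ‖z‖ < 1) :
    ∫ t in (0 : ℝ)..1, z * (((t : ℂ) * z) ^ p *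
        ((1 - ((t : ℂ) * z) ^ n) ^ (-b) * (1 + ((t : ℂ) * z) ^ n)⁻¹)) =
      z ^ (p + 1) / ((p : ℂ) + 1) *
        appellF1 (((p : ℂ) + 1) / n) b 1 (1 + ((p : ℂ) + 1) / n) (z ^ n) (-z ^ n) := by
  set C : ℕ × ℕ → ℂ := fun i =>
    z ^ (p + 1) * (poch b i.1 / (Nat.factorial i.1 : ℂ) * (z ^ n) ^ i.1 * (-z ^ n) ^ i.2) with hC
  have hzn : ‖z ^ n‖ < 1 := by
    rw [norm_pow]; exact pow_lt_one₀ (norm_nonneg z) hz (by omega)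
  have hCs : Summable C := (hasSum_one_sub_cpow_neg_mul_inv b hzn).summable.mul_left _
  have key : HasSum (fun i : ℕ × ℕ =>
      ∫ t in (0 : ℝ)..1, ((t : ℂ)) ^ (p + n * (i.1 + i.2)) * C i)
      (∫ t in (0 : ℝ)..1, z * (((t : ℂ) * z) ^ p *
        ((1 - ((t : ℂ) * z) ^ n) ^ (-b) * (1 + ((t : ℂ) * z) ^ n)⁻¹))) := by
    refine intervalIntegral.hasSum_integral_of_dominated_convergence (fun i _ => ‖C i‖)
      (fun i => (by fun_prop : Continuous _).aestronglyMeasurable) ?_ ?_ (by simp) ?_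
    · refine fun i => Filter.Eventually.of_forall fun t ht => ?_
      rw [uIoc_of_le zero_le_one] at ht
      rw [norm_mul, norm_pow, norm_real, Real.norm_of_nonneg ht.1.le]
      exact mul_le_of_le_one_left (norm_nonneg _) (pow_le_one₀ ht.1.le ht.2)
    · exact Filter.Eventually.of_forall fun t _ => hCs.norm
    · refine Filter.Eventually.of_forall fun t ht => ?_
      rw [uIoc_of_le zero_le_one] at ht
      have h := ((hasSum_one_sub_cpow_neg_mul_inv b
        (norm_ofReal_mul_pow_lt_one hn hz ⟨ht.1.le, ht.2⟩)).mul_left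
          (((t : ℂ) * z) ^ p)).mul_left z
      refine h.congr_fun fun i => ?_
      simp only [hC, mul_pow, pow_add, pow_mul, neg_pow ((t : ℂ) ^ n * z ^ n), neg_pow (z ^ n)]
      ring
  have hn0 : (n : ℂ) ≠ 0 := by exact_mod_cast (by omega : n ≠ 0)
  have hp0 : (p : ℂ) + 1 ≠ 0 := by exact_mod_cast p.succ_ne_zero
  have hre : 0 < (((p : ℂ) + 1) / n).re := by
    have : (((p : ℂ) + 1) / n) = (((p + 1) / n : ℝ) : ℂ) := by push_cast; rfl
    rw [this, ofReal_re]
    have : (0 : ℝ) < n := by exact_mod_cast hn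
    positivity
  have hterm (i : ℕ × ℕ) : ∫ t in (0 : ℝ)..1, ((t : ℂ)) ^ (p + n * (i.1 + i.2)) * C i =
      z ^ (p + 1) / ((p : ℂ) + 1) *
      (poch (((p : ℂ) + 1) / n) (i.1 + i.2) * poch b i.1 * poch 1 i.2 /
        (poch (1 + ((p : ℂ) + 1) / n) (i.1 + i.2) * (Nat.factorial i.1 : ℂ) *
          (Nat.factorial i.2 : ℂ)) * (z ^ n) ^ i.1 * (-z ^ n) ^ i.2) := by
    have hint : ∫ t in (0 : ℝ)..1, ((t : ℂ)) ^ (p + n * (i.1 + i.2)) =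
        1 / ((p : ℂ) + 1 + n * (i.1 + i.2)) := by
      have h : ∫ t in (0 : ℝ)..1, ((t : ℂ)) ^ (p + n * (i.1 + i.2)) =
          ((∫ t in (0 : ℝ)..1, t ^ (p + n * (i.1 + i.2)) : ℝ) : ℂ) := by
        rw [← intervalIntegral.integral_ofReal]; push_cast; rfl
      rw [h, integral_pow]
      push_cast
      simp only [one_pow, zero_pow (Nat.succ_ne_zero _), sub_zero]
      ring_nf
    have hq := poch_div_poch_one_add hre (i.1 + i.2)
    have hd : (p : ℂ) + 1 + n * (i.1 + i.2) ≠ 0 := by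
      exact_mod_cast (by omega : p + 1 + n * (i.1 + i.2) ≠ 0)
    have hq' : ((p : ℂ) + 1) / n / (((p : ℂ) + 1) / n + ((i.1 + i.2 : ℕ) : ℂ)) =
        ((p : ℂ) + 1) / ((p : ℂ) + 1 + n * (i.1 + i.2)) := by
      rw [div_add' _ _ _ hn0, div_div_div_cancel_right₀ hn0]
      push_cast
      ring_nf
    have hf : (Nat.factorial i.2 : ℂ) ≠ 0 := by exact_mod_cast Nat.factorial_ne_zero _
    rw [intervalIntegral.integral_mul_const, hint, poch_one]
    calc _ = z ^ (p + 1) / ((p : ℂ) + 1) * (((p : ℂ) + 1) / ((p : ℂ) + 1 + n * (i.1 + i.2)) *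
          (poch b i.1 / (Nat.factorial i.1 : ℂ) * (z ^ n) ^ i.1 * (-z ^ n) ^ i.2)) := by
          simp only [hC]; field_simp
      _ = z ^ (p + 1) / ((p : ℂ) + 1) * (poch (((p : ℂ) + 1) / n) (i.1 + i.2) /
          poch (1 + ((p : ℂ) + 1) / n) (i.1 + i.2) *
          (poch b i.1 / (Nat.factorial i.1 : ℂ) * (z ^ n) ^ i.1 * (-z ^ n) ^ i.2)) := by
          rw [hq, hq']
      _ = _ := by
          rw [mul_div_mul_right _ _ hf]
          ring
  simp only [hterm] at key
  rcases eq_or_ne z 0 with rfl | hz0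
  · rw [← key.tsum_eq, tsum_mul_left, zero_pow p.succ_ne_zero, zero_div, zero_mul, zero_mul]
  · have hsum := (summable_mul_left_iff (div_ne_zero (pow_ne_zero _ hz0) hp0)).1 key.summable
    rw [← key.tsum_eq, tsum_mul_left, appellF1, hsum.tsum_prod]

lemma inv_one_sub_sq_eq_sum {n : ℕ} {ζ : ℂ} (h : ζ ^ 2 ≠ 1) (h1 : 1 - ζ ^ n ≠ 0)
    (h2 : 1 + ζ ^ n ≠ 0) :
    (1 - ζ ^ 2)⁻¹ = (∑ k ∈ Finset.range n, ζ ^ (2 * k)) * ((1 - ζ ^ n)⁻¹ * (1 + ζ ^ n)⁻¹) := by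
  have h0 : 1 - ζ ^ 2 ≠ 0 := sub_ne_zero.2 h.symm
  have hg := mul_neg_geom_sum (ζ ^ 2) n
  simp only [← pow_mul] at hg
  have hg' : (1 - ζ ^ 2) * ∑ k ∈ Finset.range n, ζ ^ (2 * k) = (1 - ζ ^ n) * (1 + ζ ^ n) := by
    rw [hg]; ring
  field_simp
  rw [← hg']

theorem minimal_surface_height_z2_appell
    (n : ℕ) (hodd : Odd n) (hn : 1 ≤ n) (z : ℂ) (hz : z ∈ unitDisk) :
    segInt (fun ζ => ζ * (1 - ζ ^ n) ^ (-(2 / (n : ℂ))) * (1 - ζ ^ 2)⁻¹) z =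
      ∑ k ∈ Finset.range n, z ^ (2 * (k + 1)) / (2 * ((k : ℂ) + 1)) *
        appellF1 (2 * ((k : ℂ) + 1) / (n : ℂ)) (1 + 2 / (n : ℂ)) 1
          (1 + 2 * ((k : ℂ) + 1) / (n : ℂ)) (z ^ n) (-z ^ n) := by
  have hz1 : ‖z‖ < 1 := by simpa [unitDisk] using hz
  have hsub {w : ℂ} (hw : ‖w‖ < 1) : 1 - w ∈ slitPlane := by
    rw [sub_eq_add_neg]
    exact mem_slitPlane_of_norm_lt_one (by rwa [norm_neg])
  have hadd {w : ℂ} (hw : ‖w‖ < 1) : 1 + w ≠ 0 :=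
    slitPlane_ne_zero (mem_slitPlane_of_norm_lt_one hw)
  have hterm (k : ℕ) : z ^ (2 * (k + 1)) / (2 * ((k : ℂ) + 1)) *
        appellF1 (2 * ((k : ℂ) + 1) / (n : ℂ)) (1 + 2 / (n : ℂ)) 1
          (1 + 2 * ((k : ℂ) + 1) / (n : ℂ)) (z ^ n) (-z ^ n) =
      ∫ t in (0 : ℝ)..1, z * (((t : ℂ) * z) ^ (2 * k + 1) *
        ((1 - ((t : ℂ) * z) ^ n) ^ (-(1 + 2 / (n : ℂ))) * (1 + ((t : ℂ) * z) ^ n)⁻¹)) := by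
    have h : ((2 * k + 1 : ℕ) : ℂ) + 1 = 2 * ((k : ℂ) + 1) := by push_cast; ring
    rw [integral_eq_appellF1 hn _ _ hz1, h]
    rfl
  rw [Finset.sum_congr rfl fun k _ => hterm k, ← intervalIntegral.integral_finsetSum, segInt]
  · refine intervalIntegral.integral_congr fun t ht => ?_
    rw [uIcc_of_le zero_le_one] at ht
    have ht1 := norm_ofReal_mul_pow_lt_one hn hz1 ht
    have ht2 := norm_ofReal_mul_pow_lt_one one_le_two hz1 ht
    have h1 := slitPlane_ne_zero (hsub ht1)
    have h2 : ((t : ℂ) * z) ^ 2 ≠ 1 := (sub_ne_zero.1 (slitPlane_ne_zero (hsub ht2))).symm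
    rw [inv_one_sub_sq_eq_sum h2 h1 (hadd ht1), neg_add, cpow_add _ _ h1, cpow_neg_one,
      Finset.sum_mul, Finset.mul_sum, Finset.mul_sum]
    refine Finset.sum_congr rfl fun k _ => ?_
    ring
  · intro k _
    refine ContinuousOn.intervalIntegrable fun t ht => ContinuousAt.continuousWithinAt ?_
    rw [uIcc_of_le zero_le_one] at ht
    have ht1 := norm_ofReal_mul_pow_lt_one hn hz1 ht
    have hc : ContinuousAt (fun t : ℝ => ((t : ℂ) * z) ^ n) t := by fun_prop
    have h3 : ContinuousAt (fun t : ℝ => (1 - ((t : ℂ) * z) ^ n) ^ (-(1 + 2 / (n : ℂ)))) t :=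
      (continuousAt_const.sub hc).cpow continuousAt_const (hsub ht1)
    have h4 : ContinuousAt (fun t : ℝ => (1 + ((t : ℂ) * z) ^ n)⁻¹) t :=
      (continuousAt_const.add hc).inv₀ (hadd ht1)
    exact continuousAt_const.mul ((by fun_prop : ContinuousAt _ t).mul (h3.mul h4))
end
end
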